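/- Let φ(s) = s + ψ(s), where ψ(s) = ∑_{n≥1} c_n n^{−s} is a Dirichlet series that converges uniformly on ℂ_ε for every ε > 0 and satisfies ψ(ℂ₀) ⊂ ℂ₀, and suppose the composition operator C_φ is bounded and compact on ℋ². Then for every ε > 0 there exists a constant c > 0 such that a_n(C_φ) ≥ c·n^{−Re c₁ − ε} for all n ≥ 1, where c₁ is the constant term (the coefficient of 1^{−s}) of ψ. -/

import Mathlib

open Complex Filter MeasureTheory

noncomputable section

/-- The Hilbert space `ℋ²` of Dirichlet series with square-summable coefficients,
modeled by its coefficient sequences (indexed by `ℕ+`). -/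
abbrev H2 := ↥(lp (fun _ : ℕ+ => ℂ) 2)

/-- The Dirichlet series attached to an element of `ℋ²`; it converges on `Re s > 1/2`. -/
noncomputable def H2series (x : H2) (s : ℂ) : ℂ := ∑' n : ℕ+, x n * (n : ℂ) ^ (-s)

/-- `T` is (the bounded operator realizing) the composition operator `C_φ` on `ℋ²`:
for every `f ∈ ℋ²`, the Dirichlet series of `T f` agrees with `f ∘ φ` on `ℂ_{1/2}`. -/
def IsCompOp (φ : ℂ → ℂ) (T : H2 →L[ℂ] H2) : Prop :=
  ∀ (x : H2) (s : ℂ), 1 / 2 < s.re → H2series (T x) s = H2series x (φ s)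

/-- The `n`-th approximation number of a bounded operator: the distance in operator
norm to the operators of rank `< n`. -/
noncomputable def approxNumber {E F : Type*} [NormedAddCommGroup E] [NormedSpace ℂ E]
    [NormedAddCommGroup F] [NormedSpace ℂ F] (T : E →L[ℂ] F) (n : ℕ) : ℝ :=
  sInf {c : ℝ | ∃ R : E →L[ℂ] F,
    FiniteDimensional ℂ (LinearMap.range (R : E →ₗ[ℂ] F)) ∧
    Module.finrank ℂ (LinearMap.range (R : E →ₗ[ℂ] F)) < n ∧ c = ‖T - R‖}

/-- The Dirichlet series with coefficients `c` converges uniformly on `ℂ_ε = {Re s > ε}`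
for every `ε > 0`, with sum `φ`. -/
def DSConvUnif (c : ℕ → ℂ) (φ : ℂ → ℂ) : Prop :=
  ∀ ε : ℝ, 0 < ε →
    TendstoUniformlyOn (fun N s => ∑ n ∈ Finset.range N, LSeries.term c s n) φ
      atTop {s : ℂ | ε < s.re}

open Module in
/-- Hadamard's inequality for a family of vectors, relative to an orthonormal basis. -/
lemma norm_det_le_prod_norm {ι V : Type*} [Fintype ι] [DecidableEq ι] [LinearOrder ι]
    [LocallyFiniteOrderBot ι] [WellFoundedLT ι]
    [NormedAddCommGroup V] [InnerProductSpace ℂ V]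
    [FiniteDimensional ℂ V] (b : OrthonormalBasis ι ℂ V) (f : ι → V) :
    ‖b.toBasis.det f‖ ≤ ∏ i, ‖f i‖ := by
  have h : finrank ℂ V = Fintype.card ι := finrank_eq_card_basis b.toBasis
  set g := InnerProductSpace.gramSchmidtOrthonormalBasis h f with hg
  have h1 := Basis.det_mul_det b.toBasis g.toBasis
  have h2 : b.toBasis.det g.toBasis * g.toBasis.det f = b.toBasis.det f := by
    have := AlternatingMap.eq_smul_basis_det g.toBasis b.toBasis.det
    conv_rhs => rw [this]
    simp
  rw [← h2, norm_mul, g.coe_toBasis, b.det_to_matrix_orthonormalBasis g, one_mul, hg,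
    InnerProductSpace.gramSchmidtOrthonormalBasis_det, norm_prod]
  refine Finset.prod_le_prod (fun _ _ => norm_nonneg _) fun i _ => ?_
  refine (norm_inner_le_norm _ _).trans ?_
  simp

open Module in
/-- Hadamard's inequality for the determinant of an endomorphism. -/
lemma LinearMap.norm_det_le_prod_norm {ι V : Type*} [Fintype ι]
    [NormedAddCommGroup V] [InnerProductSpace ℂ V] [FiniteDimensional ℂ V]
    (b : OrthonormalBasis ι ℂ V) (A : V →ₗ[ℂ] V) :
    ‖LinearMap.det A‖ ≤ ∏ i, ‖A (b i)‖ := by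
  classical
  let e := Fintype.equivFin ι
  have h := _root_.norm_det_le_prod_norm (b.reindex e) (A ∘ b.reindex e)
  have h2 : (b.reindex e).toBasis.det (A ∘ b.reindex e) = LinearMap.det A := by
    have := (b.reindex e).toBasis.det_comp A (b.reindex e)
    rw [this]
    conv_lhs => enter [2, 2]; rw [← (b.reindex e).coe_toBasis]
    rw [Basis.det_self, mul_one]
  rw [h2] at h
  refine h.trans_eq ?_
  rw [← e.prod_comp]
  simp

open Module in
/-- If an endomorphism contracts by `c` on a subspace of codimension at most `m` and by `B`
everywhere, its determinant is at most `c ^ (N - m) * B ^ m`. -/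
lemma LinearMap.norm_det_le_of_norm_le {V : Type*}
    [NormedAddCommGroup V] [InnerProductSpace ℂ V] [FiniteDimensional ℂ V]
    (A : V →ₗ[ℂ] V) (K : Submodule ℂ V) {k m : ℕ} {b c : ℝ} (hN : finrank ℂ V = k + m)
    (hK : k ≤ finrank ℂ K) (hA : ∀ x, ‖A x‖ ≤ b * ‖x‖) (hAK : ∀ x ∈ K, ‖A x‖ ≤ c * ‖x‖) :
    ‖LinearMap.det A‖ ≤ c ^ k * b ^ m := by
  let v : Fin k ⊕ Fin m → V :=
    Sum.elim (fun i => (stdOrthonormalBasis ℂ K (Fin.castLE hK i) : V)) 0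
  have hv : Orthonormal ℂ ((Set.range (Sum.inl : Fin k → Fin k ⊕ Fin m)).domRestrict v) := by
    have h1 : Orthonormal ℂ (fun i : Fin k => (stdOrthonormalBasis ℂ K (Fin.castLE hK i) : V)) :=
      ((stdOrthonormalBasis ℂ K).orthonormal.comp_linearIsometry K.subtypeₗᵢ).comp _
        (Fin.castLE_injective hK)
    have h2 := h1.comp (Equiv.ofInjective _ (Sum.inl_injective (α := Fin k) (β := Fin m))).symm
      (Equiv.injective _)
    convert h2 using 1
    ext ⟨_, i, rfl⟩
    simp [v, Set.domRestrict]
  obtain ⟨e, he⟩ := hv.exists_orthonormalBasis_extension_of_card_eq (by simp [hN])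
  refine (A.norm_det_le_prod_norm e).trans ?_
  rw [Fintype.prod_sum_type]
  refine mul_le_mul ?_ ?_ (Finset.prod_nonneg fun _ _ => norm_nonneg _) ?_
  · refine (Finset.prod_le_prod (g := fun _ => c) (fun _ _ => norm_nonneg _) fun i _ => ?_).trans ?_
    · refine (hAK _ ?_).trans ?_
      · rw [he _ ⟨i, rfl⟩]
        simp [v]
      · simp
    · simp
  · refine (Finset.prod_le_prod (g := fun _ => b) (fun _ _ => norm_nonneg _) fun i _ => ?_).trans ?_
    · refine (hA _).trans ?_
      simp
    · simp
  · rcases Nat.eq_zero_or_pos k with rfl | hk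
    · simp
    · refine pow_nonneg ?_ _
      have := (norm_nonneg _).trans (hAK (v (Sum.inl ⟨0, hk⟩)) (by simp [v]))
      rw [← he _ ⟨_, rfl⟩] at this
      simpa using this

/-- The leading coefficient of a Dirichlet series can be read off from its asymptotics. -/
lemma LSeries.eq_zero_and_eq_of_tendsto {f : ℕ → ℂ} (hf : f 0 = 0)
    (ha : LSeries.abscissaOfAbsConv f < ⊤) {n : ℕ} (hn : 0 < n) {L : ℂ}
    (hL : Tendsto (fun x : ℝ => (n : ℂ) ^ (x : ℂ) * LSeries f x) atTop (nhds L)) :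
    (∀ k < n, f k = 0) ∧ f n = L := by
  have key : ∀ k < n, f k = 0 := by
    intro k
    induction k using Nat.strong_induction_on with
    | _ k ih =>
      intro hk
      rcases k with _ | j
      · exact hf
      have h1 := LSeries.tendsto_cpow_mul_atTop (n := j)
        (fun m hm => ih m (by omega) (by omega)) ha
      have hn' : (0 : ℝ) < n := mod_cast hn
      have h2 : Tendsto (fun x : ℝ => (((((j + 1 : ℕ) : ℝ) / n) ^ x : ℝ) : ℂ)) atTop
          (nhds ((0 : ℝ) : ℂ)) := by
        refine (tendsto_rpow_atTop_of_base_lt_one _ ?_ ?_).ofReal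
        · have : (0 : ℝ) ≤ ((j + 1 : ℕ) : ℝ) / n := by positivity
          linarith
        · rw [div_lt_one hn']
          exact mod_cast hk
      have h3 := h2.mul hL
      rw [ofReal_zero, zero_mul] at h3
      refine tendsto_nhds_unique (h1.congr fun x => ?_) h3
      rw [← mul_assoc]
      congr 1
      rw [Real.div_rpow (by positivity) hn'.le, ofReal_div, ofReal_cpow (by positivity),
        ofReal_cpow hn'.le]
      have : (n : ℂ) ^ (x : ℂ) ≠ 0 := by
        simp [Complex.cpow_eq_zero_iff, hn.ne']
      push_cast
      rw [div_mul_cancel₀ _ this]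
  refine ⟨key, ?_⟩
  obtain ⟨j, rfl⟩ : ∃ j, n = j + 1 := ⟨n - 1, by omega⟩
  have h1 := LSeries.tendsto_cpow_mul_atTop (n := j) (fun m hm => key m (by omega)) ha
  refine tendsto_nhds_unique h1 (hL.congr fun x => ?_)
  push_cast
  rfl

/-- The coefficients of an element of `ℋ²`, extended by zero to a sequence indexed by `ℕ`. -/
def H2coeff (x : H2) (k : ℕ) : ℂ := if h : 0 < k then x ⟨k, h⟩ else 0

lemma H2coeff_zero (x : H2) : H2coeff x 0 = 0 := by simp [H2coeff]

lemma H2coeff_coe (x : H2) (k : ℕ+) : H2coeff x k = x k :=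
  dif_pos k.pos

lemma H2series_eq_LSeries (x : H2) (s : ℂ) : H2series x s = LSeries (H2coeff x) s := by
  rw [H2series, LSeries, ← PNat.coe_injective.tsum_eq]
  · refine tsum_congr fun n => ?_
    rw [LSeries.term_of_ne_zero n.ne_zero, H2coeff_coe, cpow_neg, div_eq_mul_inv]
  · intro k hk
    rcases Nat.eq_zero_or_pos k with rfl | h
    · simp at hk
    · exact ⟨⟨k, h⟩, rfl⟩

lemma abscissaOfAbsConv_H2coeff_lt_top (x : H2) :
    LSeries.abscissaOfAbsConv (H2coeff x) < ⊤ := by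
  refine (LSeries.abscissaOfAbsConv_le_of_le_const ⟨‖x‖, fun n hn => ?_⟩).trans_lt
    (by exact_mod_cast EReal.coe_lt_top 1)
  rw [H2coeff, dif_pos (Nat.pos_of_ne_zero hn)]
  exact lp.norm_apply_le_norm (by simp) x _

/-- The Dirichlet series of a unit vector. -/
lemma H2series_single (n : ℕ+) (s : ℂ) :
    H2series (lp.single 2 n (1 : ℂ)) s = (n : ℂ) ^ (-s) := by
  rw [H2series, tsum_eq_single n]
  · simp
  · intro k hk
    rw [lp.single_apply_ne _ _ _ hk, zero_mul]

lemma DSConvUnif.tendsto_atTop {c : ℕ → ℂ} {ψ : ℂ → ℂ} (h : DSConvUnif c ψ) :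
    Tendsto (fun x : ℝ => ψ x) atTop (nhds (c 1)) := by
  have h1 : TendstoUniformlyOnFilter (fun N s => ∑ n ∈ Finset.range N, LSeries.term c s n) ψ
      atTop (map (fun x : ℝ => (x : ℂ)) atTop) := by
    refine (h 1 one_pos).tendstoUniformlyOnFilter.mono_right ?_
    rw [le_principal_iff, mem_map]
    filter_upwards [eventually_gt_atTop 1] with x hx
    simpa using hx
  have h2 (n : ℕ) : Tendsto (fun s => LSeries.term c s n) (map (fun x : ℝ => (x : ℂ)) atTop)
      (nhds (if n = 1 then c 1 else 0)) := by
    rw [tendsto_map'_iff]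
    rcases n with _ | _ | n
    · simp [Function.comp_def]
    · simp [Function.comp_def, LSeries.term]
    · have hn : (1 : ℝ) < ((n + 2 : ℕ) : ℝ) := by push_cast; linarith [n.cast_nonneg (α := ℝ)]
      have h0 : Tendsto (fun x : ℝ => (((((n + 2 : ℕ) : ℝ)⁻¹ ^ x : ℝ)) : ℂ)) atTop
          (nhds ((0 : ℝ) : ℂ)) := by
        refine (tendsto_rpow_atTop_of_base_lt_one _ ?_ (inv_lt_one_of_one_lt₀ hn)).ofReal
        have : (0 : ℝ) < ((n + 2 : ℕ) : ℝ)⁻¹ := by positivity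
        linarith
      have h3 := h0.const_mul (c (n + 2))
      simp only [ofReal_zero, mul_zero] at h3
      rw [if_neg (by omega)]
      refine h3.congr fun x => ?_
      rw [Function.comp_apply, LSeries.term_of_ne_zero (by omega), div_eq_mul_inv,
        Real.inv_rpow (by positivity), ofReal_inv, ofReal_cpow (by positivity), ofReal_natCast]
  have h3 := h1.tendsto_of_eventually_tendsto
    (Eventually.of_forall fun N => tendsto_finsetSum (Finset.range N) fun n _ => h2 n) (ℓ := c 1) ?_
  · exact tendsto_map'_iff.mp h3
  · refine tendsto_const_nhds.congr' ?_
    filter_upwards [eventually_gt_atTop 1] with N hN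
    simp [hN]

/-- A composition operator with symbol `s + ψ s` has a lower triangular matrix with
diagonal entries `n ^ (-c₁)`. -/
lemma IsCompOp.single_apply {ψ : ℂ → ℂ} {c : ℕ → ℂ} (hconv : DSConvUnif c ψ)
    {T : H2 →L[ℂ] H2} (hT : IsCompOp (fun s => s + ψ s) T) (n : ℕ+) :
    (∀ k < n, T (lp.single 2 n (1 : ℂ)) k = 0) ∧
      T (lp.single 2 n (1 : ℂ)) n = (n : ℂ) ^ (-c 1) := by
  have hn : (n : ℂ) ≠ 0 := by exact_mod_cast n.ne_zero
  set y := T (lp.single 2 n (1 : ℂ))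
  have hlim : Tendsto (fun x : ℝ => (n : ℂ) ^ (x : ℂ) * LSeries (H2coeff y) x) atTop
      (nhds ((n : ℂ) ^ (-c 1))) := by
    have h1 := hconv.tendsto_atTop.neg.const_cpow (Or.inl hn)
    refine h1.congr' ?_
    filter_upwards [eventually_gt_atTop (1 / 2)] with x hx
    rw [← H2series_eq_LSeries, hT _ _ (by simpa using hx), H2series_single, ← cpow_add _ _ hn]
    congr 1
    ring
  obtain ⟨h1, h2⟩ := LSeries.eq_zero_and_eq_of_tendsto (H2coeff_zero y)
    (abscissaOfAbsConv_H2coeff_lt_top y) n.pos hlim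
  refine ⟨fun k hk => ?_, ?_⟩
  · rw [← H2coeff_coe]
    exact h1 k hk
  · rw [← H2coeff_coe]
    exact h2

open Module in
/-- A lower bound for the distance to finite rank operators of an operator whose compression to
the span of an orthonormal family is triangular. -/
lemma prod_norm_diag_le {H : Type*} [NormedAddCommGroup H] [InnerProductSpace ℂ H]
    {k m : ℕ} {e : Fin (k + m) → H} (he : Orthonormal ℂ e) (T R : H →L[ℂ] H)
    (hT : ∀ i j, i < j → inner ℂ (e i) (T (e j)) = 0)
    [FiniteDimensional ℂ (LinearMap.range (R : H →ₗ[ℂ] H))]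
    (hR : finrank ℂ (LinearMap.range (R : H →ₗ[ℂ] H)) ≤ m) :
    ∏ i, ‖inner ℂ (e i) (T (e i))‖ ≤ ‖T - R‖ ^ k * ‖T‖ ^ m := by
  let V := Submodule.span ℂ (Set.range e)
  let b₀ : Basis (Fin (k + m)) ℂ V := Basis.span he.linearIndependent
  have hb₀ (i) : (b₀ i : H) = e i := by
    exact congrArg Subtype.val (Basis.span_apply he.linearIndependent i)
  have hb₁ : Orthonormal ℂ b₀ := by
    rw [← V.subtypeₗᵢ.orthonormal_comp_iff]
    convert he using 1
    ext i
    exact hb₀ i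
  let b := b₀.toOrthonormalBasis hb₁
  have hb (i) : (b i : H) = e i := by simp [b, hb₀]
  have : FiniteDimensional ℂ V := b₀.finiteDimensional_of_finite
  let P := V.orthogonalProjectionOnto
  let A : V →ₗ[ℂ] V := (P : H →ₗ[ℂ] V) ∘ₗ (T : H →ₗ[ℂ] H) ∘ₗ V.subtype
  have hA (x : V) : A x = P (T x) := rfl
  have hP (x : H) : ‖P x‖ ≤ ‖x‖ := V.norm_orthogonalProjectionOnto_apply_le x
  have hdet : LinearMap.det A = ∏ i, inner ℂ (e i) (T (e i)) := by
    have hM (i j) : LinearMap.toMatrix b.toBasis b.toBasis A i j = inner ℂ (e i) (T (e j)) := by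
      rw [LinearMap.toMatrix_apply, b.coe_toBasis_repr_apply, b.repr_apply_apply, b.coe_toBasis,
        hA, Submodule.inner_orthogonalProjectionOnto_eq_of_mem_left, hb, hb]
    rw [← LinearMap.det_toMatrix b.toBasis, Matrix.det_of_isLowerTriangular]
    · simp [hM]
    · intro i j hij
      rw [hM]
      exact hT i j hij
  rw [← norm_prod, ← hdet]
  let R' := (R : H →ₗ[ℂ] H) ∘ₗ V.subtype
  refine A.norm_det_le_of_norm_le (LinearMap.ker R') ?_ ?_ ?_ ?_
  · rw [finrank_eq_card_basis b₀, Fintype.card_fin]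
  · have h1 := R'.finrank_range_add_finrank_ker
    rw [finrank_eq_card_basis b₀, Fintype.card_fin] at h1
    have h2 := Submodule.finrank_mono (LinearMap.range_comp_le_range V.subtype (R : H →ₗ[ℂ] H))
    have h3 : finrank ℂ (LinearMap.range R') ≤ m := h2.trans hR
    omega
  · intro x
    exact (hP _).trans (T.le_opNorm x)
  · intro x hx
    have hx' : R x = 0 := hx
    have := (T - R).le_opNorm x
    rw [_root_.sub_apply, hx', sub_zero] at this
    exact (hP _).trans this

/-- Extracting a polynomial lower bound for `d` from a lower bound for `d ^ J`. -/
lemma mul_rpow_le_of_pow_rpow_le {σ ε B d : ℝ} (hB : 0 < B) (hd : 0 ≤ d) {J m : ℕ} (hJ : 0 < J)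
    (hJε : σ ≤ ε * J) (hm : 1 ≤ m)
    (h : ((((J + 1 : ℕ) * m : ℝ)) ^ (-σ)) ^ (J + 1) ≤ d ^ J * B) :
    (B⁻¹ * (((J + 1 : ℕ) : ℝ) ^ (-σ)) ^ (J + 1)) ^ (J : ℝ)⁻¹ * (m : ℝ) ^ (-(σ + ε)) ≤ d := by
  have hm' : (1 : ℝ) ≤ m := mod_cast hm
  refine le_of_pow_le_pow_left₀ hJ.ne' hd ?_
  rw [mul_pow, Real.rpow_inv_natCast_pow (by positivity) hJ.ne']
  rw [Real.mul_rpow (by positivity) (by positivity), mul_pow] at h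
  have h1 : ((m : ℝ) ^ (-(σ + ε))) ^ J ≤ ((m : ℝ) ^ (-σ)) ^ (J + 1) := by
    rw [← Real.rpow_mul_natCast (by positivity), ← Real.rpow_mul_natCast (by positivity)]
    refine Real.rpow_le_rpow_of_exponent_le hm' ?_
    push_cast
    linarith
  calc _ ≤ B⁻¹ * (((J + 1 : ℕ) : ℝ) ^ (-σ)) ^ (J + 1) * ((m : ℝ) ^ (-σ)) ^ (J + 1) := by gcongr
    _ ≤ B⁻¹ * (d ^ J * B) := by rw [mul_assoc]; gcongr
    _ = d ^ J := by field_simp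

theorem stmt3 (ψ : ℂ → ℂ) (c : ℕ → ℂ) (hconv : DSConvUnif c ψ)
    (hmap : ∀ s : ℂ, 0 < s.re → 0 < (ψ s).re)
    (T : H2 →L[ℂ] H2) (hT : IsCompOp (fun s => s + ψ s) T)
    (hcpt : IsCompactOperator ⇑T) :
    ∀ ε : ℝ, 0 < ε → ∃ C : ℝ, 0 < C ∧ ∀ n : ℕ, 1 ≤ n →
      C * (n : ℝ) ^ (-((c 1).re + ε)) ≤ approxNumber T n := by
  intro ε hε
  set σ := (c 1).re with hσ
  have hσ0 : 0 ≤ σ := by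
    refine ge_of_tendsto ((continuous_re.tendsto _).comp hconv.tendsto_atTop) ?_
    filter_upwards [eventually_gt_atTop 0] with x hx
    exact (hmap x (by simpa using hx)).le
  obtain ⟨J, hJ0, hJ⟩ : ∃ J : ℕ, 0 < J ∧ σ ≤ ε * J := by
    obtain ⟨J, hJ⟩ := exists_nat_ge (σ / ε)
    refine ⟨J + 1, J.succ_pos, ?_⟩
    rw [div_le_iff₀' hε] at hJ
    push_cast
    linarith
  have hB : 0 < ‖T‖ + 1 := by positivity
  refine ⟨((‖T‖ + 1)⁻¹ * (((J + 1 : ℕ) : ℝ) ^ (-σ)) ^ (J + 1)) ^ (J : ℝ)⁻¹, by positivity,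
    fun m hm => ?_⟩
  refine le_csInf ⟨_, 0, ?_, ?_, rfl⟩ ?_
  · rw [ContinuousLinearMap.toLinearMap_zero, LinearMap.range_zero]
    infer_instance
  · rw [ContinuousLinearMap.toLinearMap_zero, LinearMap.range_zero, finrank_bot]
    exact hm
  rintro _ ⟨R, hfin, hR, rfl⟩
  refine mul_rpow_le_of_pow_rpow_le hB (norm_nonneg _) hJ0 hJ hm ?_
  let e : Fin (J * m + m) → H2 := fun i => lp.single 2 (Nat.succPNat i) (1 : ℂ)
  have hinner (i : Fin (J * m + m)) (x : H2) : inner ℂ (e i) x = x (Nat.succPNat i) := by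
    simp [e, lp.inner_single_left]
  have he : Orthonormal ℂ e := by
    rw [orthonormal_iff_ite]
    intro i j
    rw [hinner]
    split_ifs with hij
    · rw [hij]
      exact lp.single_apply_self _ _ _
    · refine lp.single_apply_ne _ _ _ fun hji => hij (Fin.ext ?_)
      exact Nat.succPNat_injective hji
  have hentry (n : ℕ+) := hT.single_apply hconv n
  have key := prod_norm_diag_le he T R
    (fun i j hij => by
      rw [hinner]
      exact (hentry _).1 _ (Nat.succPNat_lt_succPNat.mpr hij)) hR.le
  have hdiag (i : Fin (J * m + m)) :
      (((J + 1 : ℕ) * m : ℝ)) ^ (-σ) ≤ ‖inner ℂ (e i) (T (e i))‖ := by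
    rw [hinner, (hentry _).2, norm_natCast_cpow_of_pos (PNat.pos _), neg_re]
    refine Real.rpow_le_rpow_of_nonpos (by exact_mod_cast PNat.pos _) ?_ (by linarith)
    have := i.2
    rw [Nat.succPNat_coe]
    exact_mod_cast (by rw [Nat.succ_mul]; omega : (i : ℕ).succ ≤ (J + 1) * m)
  have h1 : ((((J + 1 : ℕ) * m : ℝ)) ^ (-σ)) ^ (J * m + m) ≤ ‖T - R‖ ^ (J * m) * ‖T‖ ^ m := by
    refine le_trans ?_ key
    simpa using Finset.prod_le_prod (s := Finset.univ) (fun _ _ => by positivity)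
      fun i _ => hdiag i
  refine le_of_pow_le_pow_left₀ (Nat.pos_iff_ne_zero.mp hm) (by positivity) ?_
  rw [← pow_mul, mul_pow, ← pow_mul, Nat.succ_mul]
  refine h1.trans ?_
  gcongr
  linarith
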